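/- Let q be an odd prime power, χ the quadratic character on F_q, f ∈ F_q[x] non-constant and not a square over the algebraic closure with f(0) ≠ 0, and let A_1, …, A_k (k ≥ 2) be distinct d-element subsets of {1,…,m}. Then R = Σ_{a_1,…,a_m ∈ F_q} ∏_{j=1}^{k} χ(f(∏_{i∈A_j} a_i)) satisfies R = O(q^{m-1}), with implied constant depending only on deg f, m, d. -/

import Mathlib

open Polynomial

theorem Polynomial.pow_sub_dvd_hasseDeriv_pow {R : Type*} [CommRing R] (f : R[X]) (N i : ℕ) :
    f ^ (N - i) ∣ hasseDeriv i (f ^ N) := by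
  induction N generalizing i with
  | zero => simp
  | succ N ih =>
    rw [pow_succ, hasseDeriv_mul]
    refine Finset.dvd_sum fun p hp => ?_
    rw [Finset.HasAntidiagonal.mem_antidiagonal] at hp
    rcases Nat.eq_zero_or_pos p.2 with h | h
    · rw [h, hasseDeriv_zero']
      have h1 : p.1 = i := by omega
      rw [h1]
      refine (pow_dvd_pow f (show N + 1 - i ≤ N - i + 1 by omega)).trans ?_
      rw [pow_succ]
      exact mul_dvd_mul_right (ih i) f
    · exact (pow_dvd_pow f (by omega)).trans ((ih p.1).mul_right _)

theorem Polynomial.eq_zero_of_sq_mul_eq_sq_mul_C {F : Type*} [Field F] {f r s : F[X]} {c : F}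
    (hc : c ≠ 0)
    (hf : ¬ ∃ g : (AlgebraicClosure F)[X], f.map (algebraMap F (AlgebraicClosure F)) = g ^ 2)
    (h : r ^ 2 * f = s ^ 2 * C c) : r = 0 ∧ s = 0 := by
  have hf0 : f ≠ 0 := fun h0 => hf ⟨0, by simp [h0]⟩
  by_cases hr : r = 0
  · subst hr
    refine ⟨rfl, ?_⟩
    have : s ^ 2 * C c = 0 := by rw [← h]; simp
    simpa [hc] using this
  exfalso
  obtain ⟨b, hb⟩ := IsAlgClosed.exists_pow_nat_eq
    (algebraMap F (AlgebraicClosure F) c) (n := 2) (by norm_num)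
  set φ := algebraMap F (AlgebraicClosure F)
  have h2 : r.map φ ^ 2 * f.map φ = (s.map φ * C b) ^ 2 := by
    have := congrArg (Polynomial.map φ) h
    simp only [Polynomial.map_mul, Polynomial.map_pow, map_C] at this
    rw [this, mul_pow, ← C_pow, hb]
  have hr' : r.map φ ≠ 0 := (Polynomial.map_ne_zero_iff φ.injective).2 hr
  obtain ⟨u, hu⟩ := (IsIntegrallyClosed.pow_dvd_pow_iff two_ne_zero).1 (Dvd.intro _ h2)
  rw [hu, mul_pow] at h2
  exact hf ⟨u, mul_left_cancel₀ (pow_ne_zero 2 hr') h2⟩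

theorem Polynomial.stepanov_independent {F : Type*} [Field F] [Fintype F] {f : F[X]}
    (hq : Odd (Fintype.card F)) (h0 : f.eval 0 ≠ 0)
    (hf : ¬ ∃ g : (AlgebraicClosure F)[X], f.map (algebraMap F (AlgebraicClosure F)) = g ^ 2)
    {D : ℕ} (hD : 2 * D + f.natDegree < Fintype.card F) (J : ℕ) (r s : ℕ → F[X])
    (hr : ∀ j, (r j).natDegree ≤ D) (hs : ∀ j, (s j).natDegree ≤ D)
    (h : ∑ j ∈ Finset.range J, (r j + s j * f ^ (Fintype.card F / 2)) * X ^ (j * Fintype.card F)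
      = 0) : ∀ j < J, r j = 0 ∧ s j = 0 := by
  induction J generalizing r s with
  | zero => intro j hj; omega
  | succ J ih =>
    set q := Fintype.card F with hq_def
    set N := q / 2
    have hN : 2 * N + 1 = q := by obtain ⟨t, ht⟩ := hq; omega
    set R' := ∑ j ∈ Finset.range J, r (j + 1) * X ^ (j * q)
    set S' := ∑ j ∈ Finset.range J, s (j + 1) * X ^ (j * q)
    have key : ∑ j ∈ Finset.range J, (r (j + 1) + s (j + 1) * f ^ N) * X ^ ((j + 1) * q)
        = X ^ q * (R' + S' * f ^ N) := by
      simp only [R', S', Finset.sum_mul, ← Finset.sum_add_distrib, Finset.mul_sum]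
      refine Finset.sum_congr rfl fun j _ => ?_
      ring
    rw [Finset.sum_range_succ', key] at h
    have hRS : (r 0 + X ^ q * R') ^ 2 * f = (s 0 + X ^ q * S') ^ 2 * f ^ q := by
      have h1 : r 0 + X ^ q * R' = - ((s 0 + X ^ q * S') * f ^ N) := by
        linear_combination h
      rw [h1, ← hN]; ring
    have hfq : (X : F[X]) ^ q ∣ f ^ q - C (f.eval 0) := by
      rw [← FiniteField.expand_card f, ← hq_def]
      have : (X : F[X]) ∣ f - C (f.eval 0) := by
        rw [X_dvd_iff]; simp [coeff_zero_eq_eval_zero]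
      obtain ⟨g, hg⟩ := this
      refine ⟨expand F q g, ?_⟩
      have := congrArg (expand F q) hg
      rwa [map_sub, map_mul, expand_C, expand_X] at this
    have hdvd : (X : F[X]) ^ q ∣ r 0 ^ 2 * f - s 0 ^ 2 * C (f.eval 0) := by
      obtain ⟨g, hg⟩ := hfq
      refine ⟨(2 * s 0 * S' + X ^ q * S' ^ 2) * f ^ q + s 0 ^ 2 * g
        - (2 * r 0 * R' + X ^ q * R' ^ 2) * f, ?_⟩
      linear_combination hRS + s 0 ^ 2 * hg
    have hzero : r 0 ^ 2 * f - s 0 ^ 2 * C (f.eval 0) = 0 := by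
      refine Polynomial.eq_zero_of_dvd_of_natDegree_lt hdvd ?_
      rw [natDegree_X_pow]
      refine lt_of_le_of_lt ((natDegree_sub_le _ _).trans (max_le ?_ ?_)) hD
      · exact natDegree_mul_le_of_le (natDegree_pow_le_of_le 2 (hr 0)) le_rfl
      · refine (natDegree_mul_C_le _ _).trans ?_
        exact (natDegree_pow_le_of_le 2 (hs 0)).trans (by omega)
    obtain ⟨hr0, hs0⟩ := eq_zero_of_sq_mul_eq_sq_mul_C h0 hf (sub_eq_zero.1 hzero)
    have hrest : R' + S' * f ^ N = 0 := by
      rw [hr0, hs0] at h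
      simpa using h
    have := ih (fun j => r (j + 1)) (fun j => s (j + 1)) (fun j => hr _) (fun j => hs _) (by
      rw [← hrest]
      simp only [R', S', Finset.sum_mul, ← Finset.sum_add_distrib]
      refine Finset.sum_congr rfl fun j _ => ?_
      ring)
    intro j hj
    rcases j with _ | j
    · exact ⟨hr0, hs0⟩
    · exact this j (by omega)

theorem Polynomial.exists_stepanov_coefficients {F : Type*} [Field F] {n D J M : ℕ}
    (g : F[X]) (hg : g.natDegree ≤ n) (c : F) (w : ℕ → F[X]) (hw : ∀ i, (w i).natDegree ≤ n)
    (h : M * (D + n + J) < 2 * (D + 1) * J) :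
    ∃ r s : ℕ → F[X], (∀ j, (r j).natDegree ≤ D) ∧ (∀ j, (s j).natDegree ≤ D) ∧
      (∃ j < J, r j ≠ 0 ∨ s j ≠ 0) ∧
      ∀ k < M, ∑ j ∈ Finset.range J, X ^ j * (g * hasseDeriv k (r j) +
        C c * ∑ p ∈ Finset.HasAntidiagonal.antidiagonal k, w p.1 * hasseDeriv p.2 (s j)) = 0 := by
  have hJ : 0 < J := by
    rcases Nat.eq_zero_or_pos J with h0 | h0
    · subst h0; simp at h
    · exact h0
  let V := Fin J → degreeLT F (D + 1)
  let T (k : ℕ) : V × V →ₗ[F] F[X] := ∑ j : Fin J, LinearMap.mulLeft F (X ^ (j : ℕ)) ∘ₗ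
    (LinearMap.mulLeft F g ∘ₗ hasseDeriv k ∘ₗ (degreeLT F (D + 1)).subtype ∘ₗ LinearMap.proj j ∘ₗ
        LinearMap.fst F V V +
      LinearMap.mulLeft F (C c) ∘ₗ (∑ p ∈ Finset.HasAntidiagonal.antidiagonal k,
        LinearMap.mulLeft F (w p.1) ∘ₗ hasseDeriv p.2) ∘ₗ
        (degreeLT F (D + 1)).subtype ∘ₗ LinearMap.proj j ∘ₗ LinearMap.snd F V V)
  have hT (k : ℕ) (v : V × V) : T k v = ∑ j : Fin J, X ^ (j : ℕ) *
      (g * hasseDeriv k (v.1 j : F[X]) +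
        C c * ∑ p ∈ Finset.HasAntidiagonal.antidiagonal k, w p.1 * hasseDeriv p.2 (v.2 j : F[X])) := by
    simp only [T, LinearMap.sum_apply, LinearMap.comp_apply, LinearMap.add_apply,
      LinearMap.mulLeft_apply]
    rfl
  have hdeg (v : degreeLT F (D + 1)) : (v : F[X]).natDegree ≤ D := by
    have := mem_degreeLT.1 v.2
    rw [Polynomial.natDegree_le_iff_degree_le]
    exact Order.le_of_lt_succ this
  let Φ : V × V →ₗ[F] (Fin M × Fin (D + n + J) → F) :=
    LinearMap.pi fun kb => lcoeff F kb.2 ∘ₗ T kb.1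
  have : FiniteDimensional F (degreeLT F (D + 1)) :=
    Module.Finite.equiv (degreeLTEquiv F (D + 1)).symm
  have hfin : Module.finrank F (degreeLT F (D + 1)) = D + 1 := by
    rw [(degreeLTEquiv F (D + 1)).finrank_eq]; simp
  have hker : LinearMap.ker Φ ≠ ⊥ := by
    apply LinearMap.ker_ne_bot_of_finrank_lt
    simp only [V, Module.finrank_prod, Module.finrank_pi_fintype, hfin, Module.finrank_self, mul_one,
      Fintype.card_prod, Fintype.card_fin, Finset.sum_const, Finset.card_univ, smul_eq_mul]
    linarith
  obtain ⟨v, hv, hv0⟩ := Submodule.exists_mem_ne_zero_of_ne_bot hker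
  refine ⟨fun j => if hj : j < J then v.1 ⟨j, hj⟩ else 0,
    fun j => if hj : j < J then v.2 ⟨j, hj⟩ else 0, ?_, ?_, ?_, ?_⟩
  · intro j
    dsimp only
    split_ifs
    · exact hdeg _
    · simp
  · intro j
    dsimp only
    split_ifs
    · exact hdeg _
    · simp
  · by_contra! hcon
    apply hv0
    ext j : 3
    · exact congrArg Subtype.val (show v.1 j = 0 by simpa using (hcon j j.2).1)
    · exact congrArg Subtype.val (show v.2 j = 0 by simpa using (hcon j j.2).2)
  · intro k hk
    have hTk : T k v = 0 := by
      ext b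
      by_cases hb : b < D + n + J
      · have := congrFun (LinearMap.mem_ker.1 hv) (⟨k, hk⟩, ⟨b, hb⟩)
        simpa [Φ] using this
      · rw [coeff_zero]
        apply coeff_eq_zero_of_natDegree_lt
        refine lt_of_le_of_lt (b := (J - 1) + (n + D)) ?_ (by omega)
        rw [hT]
        refine natDegree_sum_le_of_forall_le _ _ fun j _ => ?_
        refine natDegree_mul_le_of_le ((natDegree_X_pow_le _).trans (by omega)) ?_
        refine natDegree_add_le_of_degree_le ?_ ?_
        · exact natDegree_mul_le_of_le hg
            ((natDegree_hasseDeriv_le _ _).trans ((Nat.sub_le _ _).trans (hdeg _)))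
        · refine (natDegree_C_mul_le _ _).trans ?_
          refine natDegree_sum_le_of_forall_le _ _ fun p _ => ?_
          exact natDegree_mul_le_of_le (hw _)
            ((natDegree_hasseDeriv_le _ _).trans ((Nat.sub_le _ _).trans (hdeg _)))
    rw [hT] at hTk
    rw [Finset.sum_range, ← hTk]
    refine Finset.sum_congr rfl fun j _ => ?_
    simp

theorem Polynomial.X_sub_C_pow_dvd_of_hasseDeriv_eval_eq_zero {F : Type*} [Field F] {p : F[X]}
    {a : F} {M : ℕ} (h : ∀ k < M, (hasseDeriv k p).eval a = 0) : (X - C a) ^ M ∣ p := by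
  rw [X_sub_C_pow_dvd_iff, X_pow_dvd_iff]
  intro k hk
  have := h k hk
  rwa [← taylor_coeff, taylor_apply] at this

theorem Polynomial.stepanov_card_le {F : Type*} [Field F] [Fintype F] [DecidableEq F] {f : F[X]}
    (hq : Odd (Fintype.card F)) (h0 : f.eval 0 ≠ 0)
    (hf : ¬ ∃ g : (AlgebraicClosure F)[X], f.map (algebraMap F (AlgebraicClosure F)) = g ^ 2)
    {D J M : ℕ} (hD : 2 * D + f.natDegree < Fintype.card F) (hM : M ≤ Fintype.card F)
    (hJ : M * (D + f.natDegree * M + J) < 2 * (D + 1) * J) (c : F) :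
    (Finset.univ.filter fun a : F => f.eval a ≠ 0 ∧ f.eval a ^ (Fintype.card F / 2) = c).card * M
      ≤ D + f.natDegree * (Fintype.card F / 2) + J * Fintype.card F := by
  set q := Fintype.card F with hq_def
  set N := q / 2
  set n := f.natDegree
  have hf0 : f ≠ 0 := fun h0 => hf ⟨0, by simp [h0]⟩
  have hw : ∀ i, ∃ w : F[X], w.natDegree ≤ n * M ∧
      (i ≤ M → f ^ M * hasseDeriv i (f ^ N) = f ^ N * w) := by
    intro i
    by_cases hi : i ≤ M
    · have : f ^ N ∣ f ^ M * hasseDeriv i (f ^ N) := by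
        refine (pow_dvd_pow f (show N ≤ M + (N - i) by omega)).trans ?_
        rw [pow_add]
        exact mul_dvd_mul_left _ (pow_sub_dvd_hasseDeriv_pow f N i)
      obtain ⟨w, hw⟩ := this
      refine ⟨w, ?_, fun _ => hw⟩
      by_cases hw0 : w = 0
      · simp [hw0]
      have h1 : (f ^ N * w).natDegree = N * n + w.natDegree := by
        rw [natDegree_mul (pow_ne_zero _ hf0) hw0, natDegree_pow]
      have h2 : (f ^ M * hasseDeriv i (f ^ N)).natDegree ≤ M * n + N * n := by
        refine natDegree_mul_le_of_le (natDegree_pow_le) ?_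
        refine (natDegree_hasseDeriv_le _ _).trans ((Nat.sub_le _ _).trans natDegree_pow_le)
      rw [hw, h1] at h2
      linarith
    · exact ⟨0, by simp, fun h => absurd h hi⟩
  choose w hwdeg hw using hw
  obtain ⟨r, s, hr, hs, ⟨j₀, hj₀, hne⟩, hrs⟩ := exists_stepanov_coefficients (f ^ M)
    (n := n * M) (natDegree_pow_le.trans (by rw [mul_comm])) c w hwdeg hJ
  set P := ∑ j ∈ Finset.range J, (r j + s j * f ^ N) * X ^ (j * q) with hP
  have hP0 : P ≠ 0 := by
    intro h
    obtain ⟨h1, h2⟩ := stepanov_independent hq h0 hf hD J r s hr hs h j₀ hj₀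
    tauto
  have hdvd : ∀ a : F, f.eval a ≠ 0 → f.eval a ^ N = c → (X - C a) ^ M ∣ P := by
    intro a ha hac
    have hsplit : P = ∑ j ∈ Finset.range J, (a ^ j) • (r j + f ^ N * s j) +
        ∑ j ∈ Finset.range J, (r j + s j * f ^ N) * ((X ^ q) ^ j - (C a) ^ j) := by
      rw [hP, ← Finset.sum_add_distrib]
      refine Finset.sum_congr rfl fun j _ => ?_
      rw [smul_eq_C_mul, C_pow, mul_comm j q, pow_mul]
      ring
    rw [hsplit]
    refine dvd_add (X_sub_C_pow_dvd_of_hasseDeriv_eval_eq_zero fun k hk => ?_) ?_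
    · have h1 : f ^ M * hasseDeriv k (∑ j ∈ Finset.range J, (a ^ j) • (r j + f ^ N * s j)) =
          ∑ j ∈ Finset.range J, C (a ^ j) * (f ^ M * hasseDeriv k (r j) +
            f ^ N * ∑ p ∈ Finset.HasAntidiagonal.antidiagonal k, w p.1 * hasseDeriv p.2 (s j)) := by
        rw [map_sum, Finset.mul_sum]
        refine Finset.sum_congr rfl fun j _ => ?_
        rw [map_smul, map_add, smul_eq_C_mul, hasseDeriv_mul, mul_left_comm, mul_add,
          Finset.mul_sum, Finset.mul_sum]
        congr 2
        refine Finset.sum_congr rfl fun p hp => ?_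
        rw [Finset.HasAntidiagonal.mem_antidiagonal] at hp
        rw [← mul_assoc, ← mul_assoc, hw p.1 (by omega)]
      have h2 := congrArg (eval a) h1
      have h3 := congrArg (eval a) (hrs k hk)
      simp only [eval_mul, eval_pow, eval_finsetSum, eval_add, eval_C, eval_X, hac,
        eval_zero] at h2 h3
      rw [h3] at h2
      exact (mul_eq_zero.1 h2).resolve_left (pow_ne_zero _ ha)
    · refine Finset.dvd_sum fun j _ => Dvd.dvd.mul_left ?_ _
      refine (?_ : (X - C a) ^ M ∣ X ^ q - C a).trans (sub_dvd_pow_sub_pow _ _ j)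
      have : (X - C a) ^ q = X ^ q - C a := by
        rw [hq_def, ← FiniteField.expand_card]; simp
      rw [← this]
      exact pow_dvd_pow _ hM
  have hprod : ∏ a ∈ Finset.univ.filter fun a : F => f.eval a ≠ 0 ∧ f.eval a ^ N = c,
      (X - C a) ^ M ∣ P := by
    refine Finset.prod_dvd_of_coprime (fun a _ b _ hab => ?_) fun a ha => ?_
    · exact (isCoprime_X_sub_C_of_isUnit_sub (sub_ne_zero.2 hab).isUnit).pow
    · rw [Finset.mem_filter] at ha
      exact hdvd a ha.2.1 ha.2.2
  have hle := natDegree_le_of_dvd hprod hP0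
  rw [natDegree_prod_of_monic _ _ fun a _ => (monic_X_sub_C a).pow M] at hle
  simp only [natDegree_pow, natDegree_X_sub_C, mul_one, Finset.sum_const, smul_eq_mul] at hle
  refine hle.trans (natDegree_sum_le_of_forall_le _ _ fun j hj => ?_)
  rw [Finset.mem_range] at hj
  refine natDegree_mul_le_of_le (natDegree_add_le_of_degree_le ((hr j).trans (by omega)) ?_) ?_
  · refine natDegree_mul_le_of_le (hs j) (natDegree_pow_le.trans (by rw [mul_comm]))
  · exact (natDegree_X_pow_le _).trans (Nat.mul_le_mul_right _ hj.le)

theorem Polynomial.exists_odd_rootMultiplicity {K : Type*} [Field K] [IsAlgClosed K] {f : K[X]}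
    (hf : ¬ ∃ g : K[X], f = g ^ 2) : ∃ α, Odd (f.rootMultiplicity α) := by
  classical
  by_contra! hcon
  apply hf
  obtain ⟨b, hb⟩ := IsAlgClosed.exists_pow_nat_eq f.leadingCoeff (n := 2) (by norm_num)
  refine ⟨C b * ∏ a ∈ f.roots.toFinset, (X - C a) ^ (f.roots.count a / 2), ?_⟩
  conv_lhs => rw [(IsAlgClosed.splits f).eq_prod_roots]
  rw [mul_pow, ← C_pow, hb, Finset.prod_multiset_map_count, ← Finset.prod_pow]
  congr 1
  refine Finset.prod_congr rfl fun a _ => ?_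
  rw [← pow_mul, Nat.div_mul_cancel]
  rw [count_roots]
  exact even_iff_two_dvd.1 (Nat.not_odd_iff_even.1 (hcon a))

theorem Polynomial.exists_X_pow_sub_C_pow_eq_odd_pow_mul {K : Type*} [Field K] (p : ℕ)
    [Fact p.Prime] [CharP K p] (hp : p ≠ 2) {β : K} (hβ : β ≠ 0) {e : ℕ} (he : e ≠ 0) :
    ∃ (o : ℕ) (h : K[X]), Odd o ∧ h.eval β ≠ 0 ∧ X ^ e - C (β ^ e) = (X - C β) ^ o * h := by
  have hpp : p.Prime := Fact.out
  obtain ⟨v, e', hdvd, rfl⟩ := Nat.exists_eq_pow_mul_and_not_dvd he p hpp.ne_one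
  have he' : e' ≠ 0 := by rintro rfl; simp at hdvd
  set u : K[X] := X ^ e' - C (β ^ e')
  have hsep : u.Separable := separable_X_pow_sub_C' p e' _ hdvd (pow_ne_zero _ hβ)
  have hu0 : u ≠ 0 := hsep.ne_zero
  obtain ⟨h, hu, hh⟩ := exists_eq_pow_rootMultiplicity_mul_and_not_dvd u hu0 β
  have h1 : u.rootMultiplicity β = 1 := by
    refine le_antisymm (rootMultiplicity_le_one_of_separable hsep β) ?_
    exact (rootMultiplicity_pos hu0).2 (by simp [u])
  refine ⟨p ^ v, h ^ p ^ v, (hpp.odd_of_ne_two hp).pow, ?_, ?_⟩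
  · rw [eval_pow]
    refine pow_ne_zero _ ?_
    rwa [dvd_iff_isRoot] at hh
  · rw [← mul_pow, ← pow_one (X - C β), ← h1, ← hu, sub_pow_char_pow, ← C_pow,
      ← pow_mul, ← pow_mul, mul_comm e']

theorem Polynomial.not_isSquare_prod_comp {F : Type*} [Field F] {K : Type*} [Field K]
    [IsAlgClosed K] (p : ℕ) [Fact p.Prime] [CharP K p] (hp : p ≠ 2) (φ : F →+* K) {f : F[X]}
    (h0 : f.eval 0 ≠ 0) {α : K} (hα : Odd ((f.map φ).rootMultiplicity α)) {ι : Type*}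
    {J : Finset ι} {j₀ : ι} (hj₀ : j₀ ∈ J) {c : ι → F} (hc : c j₀ ≠ 0)
    (hJ : ∀ j ∈ J, j ≠ j₀ → (f.map φ).eval (φ (c j) * α / φ (c j₀)) ≠ 0) {e : ℕ} (he : e ≠ 0) :
    ¬ ∃ g : K[X], (∏ j ∈ J, f.comp (C (c j) * X ^ e)).map φ = g ^ 2 := by
  classical
  rintro ⟨g, hg⟩
  have hc' : φ (c j₀) ≠ 0 := (_root_.map_ne_zero φ).2 hc
  have hf0 : f.map φ ≠ 0 := by
    intro h
    rw [h] at hα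
    simp at hα
  have hα0 : α ≠ 0 := by
    rintro rfl
    have : (f.map φ).IsRoot 0 := (rootMultiplicity_pos hf0).1 hα.pos
    rw [IsRoot, ← map_zero φ, eval_map_apply] at this
    exact h0 (φ.injective this)
  obtain ⟨β, hβ⟩ := IsAlgClosed.exists_pow_nat_eq (α / φ (c j₀)) (Nat.pos_of_ne_zero he)
  have hβ0 : β ≠ 0 := by
    rintro rfl
    rw [zero_pow he] at hβ
    exact div_ne_zero hα0 hc' hβ.symm
  obtain ⟨o, h, ho, hh, heq⟩ := exists_X_pow_sub_C_pow_eq_odd_pow_mul p hp hβ0 he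
  obtain ⟨r, hr, hr'⟩ := exists_eq_pow_rootMultiplicity_mul_and_not_dvd (f.map φ) hf0 α
  set n := (f.map φ).rootMultiplicity α
  have hfac : (f.map φ).comp (C (φ (c j₀)) * X ^ e) = (X - C β) ^ (o * n) *
      ((C (φ (c j₀)) * h) ^ n * r.comp (C (φ (c j₀)) * X ^ e)) := by
    conv_lhs => rw [hr]
    have : (C (φ (c j₀)) * X ^ e - C α : K[X]) = C (φ (c j₀)) * ((X - C β) ^ o * h) := by
      rw [← heq, hβ, mul_sub, ← C_mul, mul_div_cancel₀ _ hc']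
    rw [mul_comp, pow_comp, sub_comp, X_comp, C_comp, this]
    ring
  have hprod : (∏ j ∈ J, f.comp (C (c j) * X ^ e)).map φ = (X - C β) ^ (o * n) *
      (((C (φ (c j₀)) * h) ^ n * r.comp (C (φ (c j₀)) * X ^ e)) *
        ∏ j ∈ J.erase j₀, (f.map φ).comp (C (φ (c j)) * X ^ e)) := by
    rw [Polynomial.map_prod, ← Finset.mul_prod_erase J _ hj₀]
    simp only [map_comp, Polynomial.map_mul, map_C, Polynomial.map_pow, map_X]
    rw [hfac, mul_assoc]
  set w := ((C (φ (c j₀)) * h) ^ n * r.comp (C (φ (c j₀)) * X ^ e)) *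
        ∏ j ∈ J.erase j₀, (f.map φ).comp (C (φ (c j)) * X ^ e)
  have hw : w.eval β ≠ 0 := by
    simp only [w, eval_mul, eval_pow, eval_C, eval_comp, eval_X, eval_prod, hβ]
    refine mul_ne_zero (mul_ne_zero (pow_ne_zero _ (mul_ne_zero hc' hh)) ?_) ?_
    · rw [mul_div_cancel₀ _ hc']
      rwa [dvd_iff_isRoot] at hr'
    · rw [Finset.prod_ne_zero_iff]
      intro j hj
      rw [Finset.mem_erase] at hj
      rw [← mul_div_assoc]
      exact hJ j hj.2 hj.1
  have hw0 : w ≠ 0 := by rintro h; rw [h] at hw; simp at hw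
  rw [hg] at hprod
  have hmul : (X - C β) ^ (o * n) * w ≠ 0 :=
    mul_ne_zero (pow_ne_zero _ (X_sub_C_ne_zero β)) hw0
  have hcount := congrArg (rootMultiplicity β) hprod
  rw [rootMultiplicity_mul hmul, rootMultiplicity_X_sub_C_pow, rootMultiplicity_eq_zero hw,
    pow_two, rootMultiplicity_mul (by rw [← pow_two, hprod]; exact hmul)] at hcount
  have hodd : Odd (o * n) := ho.mul hα
  rw [← Nat.not_even_iff_odd] at hodd
  exact hodd ⟨g.rootMultiplicity β, by omega⟩

theorem quadraticChar_abs_sum_eval_le {F : Type*} [Field F] [Fintype F] [DecidableEq F]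
    (hq : Odd (Fintype.card F)) {f : F[X]} (h0 : f.eval 0 ≠ 0)
    (hf : ¬ ∃ g : (AlgebraicClosure F)[X], f.map (algebraMap F (AlgebraicClosure F)) = g ^ 2) :
    |∑ x : F, (quadraticChar F (f.eval x) : ℝ)| ≤
      (7 * f.natDegree + 14) * √(Fintype.card F) := by
  set q := Fintype.card F with hq_def
  set n := f.natDegree
  have hchar : ringChar F ≠ 2 := by
    intro h
    rw [FiniteField.even_card_iff_char_two] at h
    rw [Nat.odd_iff] at hq
    omega
  have hf0 : f ≠ 0 := by rintro rfl; simp at h0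
  have hsq : √(q : ℝ) * √(q : ℝ) = q := Real.mul_self_sqrt (by positivity)
  have hsq0 : 0 ≤ √(q : ℝ) := Real.sqrt_nonneg _
  have hq1 : 1 ≤ q := hq.pos
  have hn0 : (0 : ℝ) ≤ n := by positivity
  rcases lt_or_ge (Nat.sqrt q) (n + 3) with hlt | hge
  · have h1 : |∑ x : F, (quadraticChar F (f.eval x) : ℝ)| ≤ q := by
      refine (Finset.abs_sum_le_sum_abs _ _).trans ?_
      refine (Finset.sum_le_card_nsmul _ _ 1 fun x _ => ?_).trans (by simp [hq_def])
      rcases eq_or_ne (f.eval x) 0 with h | h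
      · simp [h]
      · rcases quadraticChar_dichotomy h with h | h <;> simp [h]
    have h2 : √(q : ℝ) ≤ n + 3 := by
      refine Real.sqrt_le_iff.2 ⟨by positivity, ?_⟩
      have := Nat.sqrt_lt.1 hlt
      have : (q : ℝ) < ((n + 3) * (n + 3) : ℕ) := by exact_mod_cast this
      push_cast at this
      nlinarith
    nlinarith
  · set M := Nat.sqrt q with hM_def
    have hMq : M * M ≤ q := Nat.sqrt_le q
    have hqM : q < (M + 1) * (M + 1) := Nat.lt_succ_sqrt q
    set D := (q - n - 1) / 2
    set J := M / 2 + n + 3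
    have hnq : n + 3 ≤ q := hge.trans (Nat.sqrt_le_self q)
    have hD : 2 * D + n < q := by omega
    have hD' : q ≤ 2 * (D + 1) + n := by omega
    have hJ1 : M + 2 * n + 5 ≤ 2 * J := by omega
    have hJ2 : 2 * J ≤ M + 2 * n + 6 := by omega
    have hJ : M * (D + n * M + J) < 2 * (D + 1) * J := by
      zify at hMq hqM hge hD' hJ1 hJ2 ⊢
      nlinarith [mul_le_mul_of_nonneg_left hJ1 (show (0 : ℤ) ≤ D + 1 by positivity),
        mul_le_mul_of_nonneg_left hJ2 (show (0 : ℤ) ≤ M by positivity),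
        mul_le_mul_of_nonneg_left hMq (show (0 : ℤ) ≤ n by positivity),
        mul_le_mul_of_nonneg_left hD' (show (0 : ℤ) ≤ n by positivity),
        mul_le_mul_of_nonneg_left hge (show (0 : ℤ) ≤ n by positivity),
        mul_le_mul_of_nonneg_left hge (show (0 : ℤ) ≤ M by positivity)]
    have hcard : ∀ ε : ℤ, ε ≠ 0 →
        ((Finset.univ.filter fun x : F => quadraticChar F (f.eval x) = ε).card : ℝ) ≤
          q / 2 + (3 * n + 7) * √q := by
      intro ε hε
      have h1 := stepanov_card_le hq h0 hf hD (Nat.sqrt_le_self q) hJ (ε : F)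
      have h2 : (Finset.univ.filter fun x : F => quadraticChar F (f.eval x) = ε).card ≤
          (Finset.univ.filter fun a : F => f.eval a ≠ 0 ∧
            f.eval a ^ (Fintype.card F / 2) = (ε : F)).card := by
        refine Finset.card_le_card fun x hx => ?_
        simp only [Finset.mem_filter, Finset.mem_univ, true_and] at hx ⊢
        refine ⟨fun h => hε ?_, ?_⟩
        · rw [← hx, h, quadraticChar_zero]
        · rw [← hx, quadraticChar_eq_pow_of_char_ne_two' hchar]
      set S := (Finset.univ.filter fun x : F => quadraticChar F (f.eval x) = ε).card
      have h3 : S * M ≤ D + n * (q / 2) + J * q := (Nat.mul_le_mul_right M h2).trans h1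
      have h4 : 2 * (S * M) ≤ q + n * q + (M + 2 * n + 6) * q := by
        have : 2 * (n * (q / 2)) ≤ n * q := by
          rw [← mul_assoc, mul_comm 2 n, mul_assoc]
          exact Nat.mul_le_mul_left _ (Nat.mul_div_le q 2)
        have h5 := Nat.mul_le_mul_right q hJ2
        have h6 : 2 * D ≤ q := by omega
        nlinarith
      have h4' : 2 * ((S : ℝ) * M) ≤ q + n * q + (M + 2 * n + 6) * q := by exact_mod_cast h4
      have hM3 : (3 : ℝ) ≤ M := by
        have : 3 ≤ M := by omega
        exact_mod_cast this
      have hsqM : √(q : ℝ) ≤ 2 * M := by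
        refine Real.sqrt_le_iff.2 ⟨by positivity, ?_⟩
        have : (q : ℝ) < (M + 1) * (M + 1) := by exact_mod_cast hqM
        nlinarith
      refine le_of_mul_le_mul_right ?_ (show (0 : ℝ) < M by linarith)
      have h7 : (q : ℝ) ≤ 2 * M * √q := by
        calc (q : ℝ) = √q * √q := hsq.symm
          _ ≤ 2 * M * √q := by gcongr
      have h8 : (3 * n + 7) * (q : ℝ) ≤ (3 * n + 7) * (2 * M * √q) := by gcongr
      linarith
    have hsum : ∑ x : F, (quadraticChar F (f.eval x) : ℝ) =
        (Finset.univ.filter fun x : F => quadraticChar F (f.eval x) = 1).card -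
        (Finset.univ.filter fun x : F => quadraticChar F (f.eval x) = -1).card := by
      rw [Finset.card_filter, Finset.card_filter]
      push_cast
      rw [← Finset.sum_sub_distrib]
      refine Finset.sum_congr rfl fun x _ => ?_
      rcases eq_or_ne (f.eval x) 0 with h | h
      · simp [h]
      · rcases quadraticChar_dichotomy h with h | h <;> norm_num [h]
    have htot : (q : ℝ) ≤
        (Finset.univ.filter fun x : F => quadraticChar F (f.eval x) = 1).card +
        (Finset.univ.filter fun x : F => quadraticChar F (f.eval x) = -1).card + n := by
      have h1 : Finset.univ ⊆ (Finset.univ.filter fun x : F => quadraticChar F (f.eval x) = 1) ∪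
          (Finset.univ.filter fun x : F => quadraticChar F (f.eval x) = -1) ∪
          f.roots.toFinset := by
        intro x _
        rcases eq_or_ne (f.eval x) 0 with h | h
        · simp [h, hf0]
        · rcases quadraticChar_dichotomy h with h | h <;> simp [h, -quadraticChar_apply]
      have h2 := (Finset.card_le_card h1).trans ((Finset.card_union_le _ _).trans
        (Nat.add_le_add (Finset.card_union_le _ _)
          ((Multiset.toFinset_card_le _).trans (card_roots' f))))
      rw [Finset.card_univ] at h2
      exact_mod_cast h2
    have hp := hcard 1 one_ne_zero
    have hm := hcard (-1) (by norm_num)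
    have h1 : (1 : ℝ) ≤ √q := by
      rw [Real.one_le_sqrt]
      exact_mod_cast hq1
    have hn : (n : ℝ) ≤ n * √q := le_mul_of_one_le_right hn0 h1
    rw [hsum, abs_le]
    constructor <;> nlinarith

theorem quadraticChar_abs_le_one {F : Type*} [Field F] [Fintype F] [DecidableEq F] (a : F) :
    |(quadraticChar F a : ℝ)| ≤ 1 := by
  rcases eq_or_ne a 0 with h | h
  · simp [h]
  · rcases quadraticChar_dichotomy h with h | h <;> simp [h, -quadraticChar_apply]

theorem Finset.abs_prod_le_one {ι : Type*} (J : Finset ι) (g : ι → ℝ) (h : ∀ j ∈ J, |g j| ≤ 1) :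
    |∏ j ∈ J, g j| ≤ 1 := by
  rw [Finset.abs_prod]
  exact Finset.prod_le_one (fun _ _ => abs_nonneg _) h

theorem Fintype.sum_eq_zero_add_sum_units {F : Type*} [Field F] [Fintype F] [DecidableEq F]
    (g : F → ℝ) : ∑ x : F, g x = g 0 + ∑ s : Fˣ, g s := by
  rw [← Finset.add_sum_erase _ _ (Finset.mem_univ (0 : F))]
  congr 1
  symm
  refine Finset.sum_bij (fun s _ => (s : F)) (fun s _ => by simp) (fun s _ t _ h => Units.ext h)
    (fun x hx => ?_) (fun _ _ => rfl)
  exact ⟨Units.mk0 x (Finset.ne_of_mem_erase hx), by simp, rfl⟩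

theorem quadraticChar_abs_sum_units_prod_le {F : Type*} [Field F] [Fintype F] [DecidableEq F]
    (hq : Odd (Fintype.card F)) {f : F[X]} (h0 : f.eval 0 ≠ 0) {α : AlgebraicClosure F}
    (hα : Odd ((f.map (algebraMap F (AlgebraicClosure F))).rootMultiplicity α)) {ι : Type*}
    {J : Finset ι} {j₀ : ι} (hj₀ : j₀ ∈ J) (c : ι → Fˣ)
    (hJ : ∀ j ∈ J, j ≠ j₀ → (f.map (algebraMap F (AlgebraicClosure F))).eval
      (algebraMap F _ (c j) * α / algebraMap F _ (c j₀)) ≠ 0) {e : ℕ} (he : e ≠ 0) :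
    |∑ s : Fˣ, ∏ j ∈ J, (quadraticChar F (f.eval (c j * s ^ e)) : ℝ)| ≤
      (7 * (J.card * f.natDegree * e) + 14) * √(Fintype.card F) + 1 := by
  obtain ⟨p, hchar⟩ := CharP.exists F
  obtain ⟨n, hp, hn⟩ := FiniteField.card F p
  have : Fact p.Prime := ⟨hp⟩
  have : CharP (AlgebraicClosure F) p :=
    charP_of_injective_algebraMap (algebraMap F (AlgebraicClosure F)).injective p
  have hp2 : p ≠ 2 := by
    rintro rfl
    rw [hn, Nat.odd_pow_iff n.ne_zero] at hq
    exact absurd hq (by decide)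
  set G := ∏ j ∈ J, f.comp (C (c j : F) * X ^ e)
  have hG : ∀ x : F, G.eval x = ∏ j ∈ J, f.eval (c j * x ^ e) := by
    intro x
    simp [G, eval_prod]
  have hG0 : G.eval 0 ≠ 0 := by
    rw [hG, Finset.prod_ne_zero_iff]
    intro j _
    simpa [he] using h0
  have hdeg : G.natDegree ≤ J.card * f.natDegree * e := by
    refine (natDegree_prod_le _ _).trans ?_
    rw [mul_assoc, ← smul_eq_mul]
    refine Finset.sum_le_card_nsmul _ _ _ fun j _ => ?_
    refine natDegree_comp_le.trans ?_
    exact Nat.mul_le_mul_left _ (natDegree_C_mul_X_pow_le _ _)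
  have hweil := quadraticChar_abs_sum_eval_le hq hG0
    (not_isSquare_prod_comp p hp2 _ h0 hα hj₀ (c := fun j => (c j : F)) (c j₀).ne_zero hJ he)
  have hsum : ∀ x : F, (quadraticChar F (G.eval x) : ℝ) =
      ∏ j ∈ J, (quadraticChar F (f.eval (c j * x ^ e)) : ℝ) := by
    intro x
    rw [hG, map_prod]
    push_cast
    rfl
  rw [Fintype.sum_eq_zero_add_sum_units] at hweil
  have h1 : |(quadraticChar F (G.eval 0) : ℝ)| ≤ 1 := quadraticChar_abs_le_one _
  have h2 : (7 * (G.natDegree : ℝ) + 14) * √(Fintype.card F) ≤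
      (7 * (J.card * f.natDegree * e) + 14) * √(Fintype.card F) := by
    gcongr
    exact_mod_cast hdeg
  simp only [← hsum]
  rw [abs_le] at *
  constructor <;> linarith

theorem card_filter_eval_div_eq_zero_le {F K : Type*} [Field F] [Fintype F] [DecidableEq F]
    [Field K] (φ : F →+* K) {f : K[X]} (hf : f ≠ 0) {α : K} (hα : α ≠ 0) {m : ℕ}
    {A B : Finset (Fin m)} {i : Fin m} (hiA : i ∈ A) (hiB : i ∉ B)
    [DecidablePred fun u : Fin m → Fˣ =>
      f.eval (φ (∏ i ∈ A, u i : Fˣ) * α / φ (∏ i ∈ B, u i : Fˣ)) = 0] :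
    (Finset.univ.filter fun u : Fin m → Fˣ =>
      f.eval (φ (∏ i ∈ A, u i : Fˣ) * α / φ (∏ i ∈ B, u i : Fˣ)) = 0).card ≤
      f.natDegree * Fintype.card F ^ (m - 1) := by
  classical
  have hle : Fintype.card ({l : Fin m // l ≠ i} → Fˣ) ≤ Fintype.card F ^ (m - 1) := by
    rw [Fintype.card_fun, Fintype.card_subtype_compl, Fintype.card_fin, Fintype.card_subtype_eq]
    exact Nat.pow_le_pow_left (Fintype.card_le_of_injective _ Units.val_injective) _
  refine le_trans ?_ (Nat.mul_le_mul ((Multiset.toFinset_card_le _).trans (card_roots' f)) hle)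
  rw [← Finset.card_univ, ← Finset.card_product]
  refine Finset.card_le_card_of_injOn (fun u =>
    (φ (∏ i ∈ A, u i : Fˣ) * α / φ (∏ i ∈ B, u i : Fˣ), fun l => u l)) ?_ ?_
  · intro u hu
    simpa [hf] using hu
  · intro u _ v _ huv
    simp only [Prod.mk.injEq] at huv
    obtain ⟨h1, h2⟩ := huv
    have h3 : ∀ l, l ≠ i → u l = v l := fun l hl => congrFun h2 ⟨l, hl⟩
    have hB : ∏ i ∈ B, u i = ∏ i ∈ B, v i :=
      Finset.prod_congr rfl fun l hl => h3 l fun h => hiB (h ▸ hl)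
    have hne : φ (∏ i ∈ B, v i : Fˣ) ≠ 0 := (_root_.map_ne_zero φ).2 (Units.ne_zero _)
    rw [hB, div_left_inj' hne, mul_left_inj' hα] at h1
    have hA : ∏ i ∈ A, u i = ∏ i ∈ A, v i := Units.ext (φ.injective h1)
    rw [← Finset.mul_prod_erase A _ hiA, ← Finset.mul_prod_erase A v hiA,
      Finset.prod_congr rfl fun l hl => h3 l (Finset.ne_of_mem_erase hl)] at hA
    funext l
    rcases eq_or_ne l i with rfl | hl
    · exact mul_right_cancel hA
    · exact h3 l hl

theorem card_filter_exists_eq_zero_le {F : Type*} [Field F] [Fintype F] [DecidableEq F] (m : ℕ) :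
    (Finset.univ.filter fun a : Fin m → F => ∃ i, a i = 0).card ≤
      m * Fintype.card F ^ (m - 1) := by
  have h1 : (Finset.univ.filter fun a : Fin m → F => ∃ i, a i = 0) ⊆
      Finset.univ.biUnion fun i => Finset.univ.filter fun a : Fin m → F => a i = 0 := by
    intro a ha
    simpa using ha
  refine (Finset.card_le_card h1).trans (Finset.card_biUnion_le.trans ?_)
  refine (Finset.sum_le_card_nsmul _ _ (Fintype.card F ^ (m - 1)) fun i _ => ?_).trans (by simp)
  have hcard : Fintype.card ({l : Fin m // l ≠ i} → F) = Fintype.card F ^ (m - 1) := by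
    rw [Fintype.card_fun, Fintype.card_subtype_compl, Fintype.card_fin, Fintype.card_subtype_eq]
  rw [← hcard, ← Finset.card_univ]
  refine Finset.card_le_card_of_injOn (fun a l => a l) (fun _ _ => by simp) fun a ha b hb hab => ?_
  simp only [Finset.coe_filter, Finset.mem_univ, true_and, Set.mem_ofPred_eq] at ha hb
  funext l
  rcases eq_or_ne l i with rfl | hl
  · rw [ha, hb]
  · exact congrFun hab ⟨l, hl⟩

theorem abs_sum_le_abs_sum_units_add {F : Type*} [Field F] [Fintype F] [DecidableEq F] (m : ℕ)
    (g : (Fin m → F) → ℝ) (hg : ∀ a, |g a| ≤ 1) :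
    |∑ a, g a| ≤ |∑ u : Fin m → Fˣ, g fun i => u i| + m * Fintype.card F ^ (m - 1) := by
  rw [← Finset.sum_filter_add_sum_filter_not _ fun a : Fin m → F => ∃ i, a i = 0, add_comm]
  refine (abs_add_le _ _).trans (add_le_add (le_of_eq ?_) ?_)
  · congr 1
    symm
    refine Finset.sum_bij (fun u _ i => (u i : F)) (fun u _ => by simp)
      (fun u _ v _ h => ?_) (fun a ha => ?_) (fun _ _ => rfl)
    · funext i
      exact Units.ext (congrFun h i)
    · simp only [not_exists, Finset.mem_filter, Finset.mem_univ, true_and] at ha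
      exact ⟨fun i => Units.mk0 (a i) (ha i), by simp, rfl⟩
  · refine (Finset.abs_sum_le_sum_abs _ _).trans ?_
    refine (Finset.sum_le_card_nsmul _ _ 1 fun a _ => hg a).trans ?_
    rw [nsmul_eq_mul, mul_one]
    exact_mod_cast card_filter_exists_eq_zero_le m

/-- Rescaling the coordinate `i` by `s * t ^ (1 - d)` and the others by `t` multiplies the monomial
of a `d`-set by `s` if the set contains `i`, and by `t ^ d` otherwise. -/
theorem prod_mul_ite_eq {G : Type*} [CommGroup G] {m d : ℕ} (i : Fin m) (A : Finset (Fin m))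
    (hA : A.card = d) (s t : G) (u : Fin m → G) :
    ∏ l ∈ A, (u l * if l = i then s * t / t ^ d else t) =
      (∏ l ∈ A, u l) * if i ∈ A then s else t ^ d := by
  rw [Finset.prod_mul_distrib]
  congr 1
  split_ifs with h
  · rw [← Finset.mul_prod_erase A _ h, if_pos rfl,
      Finset.prod_congr rfl fun l hl => if_neg (Finset.ne_of_mem_erase hl), Finset.prod_const,
      Finset.card_erase_of_mem h, hA]
    have : t ^ d = t * t ^ (d - 1) := by
      rw [← pow_succ', Nat.sub_add_cancel]
      rw [← hA]
      exact Finset.card_pos.2 ⟨i, h⟩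
    rw [this, div_mul_eq_mul_div, mul_assoc, mul_div_cancel_right]
  · rw [Finset.prod_congr rfl fun l hl => if_neg fun hl' : l = i => h (hl' ▸ hl),
      Finset.prod_const, hA]

theorem sum_units_prod_eq {F : Type*} [Field F] [Fintype F] [DecidableEq F] {m d k : ℕ}
    (i : Fin m) (A : Fin k → Finset (Fin m)) (hA : ∀ j, (A j).card = d) (H : F → ℝ) :
    (Fintype.card Fˣ : ℝ) ^ 2 * ∑ u : Fin m → Fˣ, ∏ j, H (∏ l ∈ A j, u l : Fˣ) =
      ∑ u : Fin m → Fˣ,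
        (∑ s : Fˣ, ∏ j with i ∈ A j, H ((∏ l ∈ A j, u l : Fˣ) * s ^ 1)) *
        ∑ t : Fˣ, ∏ j with i ∉ A j, H ((∏ l ∈ A j, u l : Fˣ) * t ^ d) := by
  have h : ∀ s t : Fˣ, ∑ u : Fin m → Fˣ, ∏ j, H (∏ l ∈ A j, u l : Fˣ) =
      ∑ u : Fin m → Fˣ, (∏ j with i ∈ A j, H ((∏ l ∈ A j, u l : Fˣ) * s ^ 1)) *
        ∏ j with i ∉ A j, H ((∏ l ∈ A j, u l : Fˣ) * t ^ d) := by
    intro s t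
    refine (Equiv.sum_comp (Equiv.mulRight fun l : Fin m => if l = i then s * t / t ^ d else t)
      fun u : Fin m → Fˣ => ∏ j, H (∏ l ∈ A j, u l : Fˣ)).symm.trans ?_
    refine Finset.sum_congr rfl fun u _ => ?_
    rw [← Finset.prod_filter_mul_prod_filter_not Finset.univ fun j => i ∈ A j]
    refine congrArg₂ (· * ·) (Finset.prod_congr rfl fun j hj => ?_)
      (Finset.prod_congr rfl fun j hj => ?_)
    all_goals
      rw [Finset.mem_filter] at hj
      simp only [Equiv.coe_mulRight, Pi.mul_apply]
      rw [prod_mul_ite_eq i (A j) (hA j)]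
      simp [hj.2]
  have h2 : ∑ _s : Fˣ, ∑ _t : Fˣ, ∑ u : Fin m → Fˣ, ∏ j, H (∏ l ∈ A j, u l : Fˣ) =
      (Fintype.card Fˣ : ℝ) ^ 2 * ∑ u : Fin m → Fˣ, ∏ j, H (∏ l ∈ A j, u l : Fˣ) := by
    simp only [Finset.sum_const, Finset.card_univ, nsmul_eq_mul]
    ring
  rw [← h2, Finset.sum_congr rfl fun s _ => Finset.sum_congr rfl fun t _ => h s t]
  simp only [Finset.sum_mul_sum]
  symm
  rw [Finset.sum_comm]
  exact Finset.sum_congr rfl fun s _ => Finset.sum_comm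

/-- Shparlinski-type estimate: for `k ≥ 2` distinct `d`-subsets
`A_1,…,A_k` of `{1,…,m}`, the sum
`R = Σ_{a∈F_q^m} ∏_j χ(f(∏_{i∈A_j} a_i))` is `O(q^{m-1})`, with implied
constant depending only on `deg f`, `m`, `d` (and `k ≤ binom(m,d)`). -/
theorem stmt_7 (D m d k : ℕ) (hd : 1 ≤ d) (hdm : d < m) (hk : 2 ≤ k) :
    ∃ C : ℝ, ∀ (F : Type) (_ : Field F) (_ : Fintype F) (_ : DecidableEq F),
      Odd (Fintype.card F) →
      ∀ f : Polynomial F, f.natDegree = D → 0 < f.natDegree →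
        (¬ ∃ g : Polynomial (AlgebraicClosure F),
          f.map (algebraMap F (AlgebraicClosure F)) = g ^ 2) →
        f.eval 0 ≠ 0 →
        ∀ A : Fin k → Finset (Fin m), Function.Injective A →
          (∀ j, (A j).card = d) →
          |(∑ a : Fin m → F, ∏ j : Fin k,
              (quadraticChar F (f.eval (∏ i ∈ A j, a i)) : ℝ))|
            ≤ C * (Fintype.card F : ℝ) ^ (m - 1) := by
  classical
  set W : ℝ := 7 * (k * D * d) + 15 with hW
  refine ⟨4 * W ^ 2 + k * k * D + m, ?_⟩
  intro F _ _ _ hq f hfD hf0 hf h0 A hA hAd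
  set q := Fintype.card F with hq_def
  set φ := algebraMap F (AlgebraicClosure F) with hφ
  obtain ⟨α, hα⟩ := exists_odd_rootMultiplicity hf
  have hfm0 : f.map φ ≠ 0 := by
    intro h
    rw [h] at hα
    simp at hα
  have hα0 : α ≠ 0 := by
    rintro rfl
    have : (f.map φ).IsRoot 0 := (rootMultiplicity_pos hfm0).1 hα.pos
    rw [IsRoot, ← map_zero φ, eval_map_apply] at this
    exact h0 (φ.injective this)
  have hq1 : 1 < q := Fintype.one_lt_card
  have hunits : Fintype.card Fˣ = q - 1 := Fintype.card_units F
  have hunits' : (Fintype.card Fˣ : ℝ) = q - 1 := by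
    rw [hunits]; push_cast [hq1.le]; ring
  have hqR : (2 : ℝ) ≤ q := by exact_mod_cast hq1
  have hsqrt1 : 1 ≤ √(q : ℝ) := by
    rw [Real.one_le_sqrt]; linarith
  have hsq : √(q : ℝ) ^ 2 = q := Real.sq_sqrt (by positivity)
  -- two of the sets are separated by a coordinate
  obtain ⟨j₁, j₂, i, hi₁, hi₂⟩ : ∃ j₁ j₂ : Fin k, ∃ i, i ∈ A j₁ ∧ i ∉ A j₂ := by
    have hne : A ⟨0, by omega⟩ ≠ A ⟨1, by omega⟩ := fun h => by
      have := hA h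
      simp at this
    by_contra! hcon
    refine hne (Finset.Subset.antisymm (fun i hi => hcon _ _ i hi) fun i hi => hcon _ _ i hi)
  set X : Fin k → (Fin m → Fˣ) → Fˣ := fun j u => ∏ l ∈ A j, u l with hX
  set H : F → ℝ := fun x => quadraticChar F (f.eval x) with hH
  have hH1 : ∀ x, |H x| ≤ 1 := fun x => quadraticChar_abs_le_one _
  -- exceptional points, where roots collide
  set bad : Finset (Fin m → Fˣ) := (Finset.univ : Finset (Fin k × Fin k)).biUnion fun jj =>
    if jj.1 ≠ jj.2 then Finset.univ.filter fun u =>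
      (f.map φ).eval (φ (X jj.1 u) * α / φ (X jj.2 u)) = 0 else ∅ with hbad
  have hbad_card : (bad.card : ℝ) ≤ k * k * D * q ^ (m - 1) := by
    have : bad.card ≤ k * k * (D * q ^ (m - 1)) := by
      refine Finset.card_biUnion_le.trans ?_
      refine (Finset.sum_le_card_nsmul _ _ (D * q ^ (m - 1)) fun jj _ => ?_).trans (by simp)
      split_ifs with hjj
      · obtain ⟨l, hl₁, hl₂⟩ : ∃ l, l ∈ A jj.1 ∧ l ∉ A jj.2 := by
          by_contra! hcon
          exact hjj (hA (Finset.eq_of_subset_of_card_le hcon (by rw [hAd, hAd])))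
        refine (card_filter_eval_div_eq_zero_le φ hfm0 hα0 hl₁ hl₂).trans ?_
        rw [natDegree_map, hfD]
      · simp
    have h' : (bad.card : ℝ) ≤ (k * k * (D * q ^ (m - 1)) : ℕ) := by exact_mod_cast this
    refine h'.trans (le_of_eq ?_)
    push_cast
    ring
  have hgood : ∀ u ∉ bad, ∀ (J : Finset (Fin k)) (j₀ : Fin k), j₀ ∈ J → ∀ e, e ≠ 0 → e ≤ d →
      |∑ s : Fˣ, ∏ j ∈ J, H (X j u * s ^ e)| ≤ W * √q := by
    intro u hu J j₀ hj₀ e he hed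
    refine (quadraticChar_abs_sum_units_prod_le hq h0 hα hj₀ (fun j => X j u) ?_ he).trans ?_
    · intro j _ hjj hev
      apply hu
      rw [hbad, Finset.mem_biUnion]
      refine ⟨(j, j₀), Finset.mem_univ _, ?_⟩
      rw [if_pos hjj, Finset.mem_filter]
      exact ⟨Finset.mem_univ _, hev⟩
    · have h1 : (J.card : ℝ) * f.natDegree * e ≤ k * D * d := by
        rw [hfD]
        have h2 : (J.card : ℝ) ≤ k := by
          exact_mod_cast (Finset.card_le_univ J).trans (by simp)
        have h3 : (e : ℝ) ≤ d := by exact_mod_cast hed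
        gcongr
      rw [hW]
      nlinarith
  have htriv : ∀ (u : Fin m → Fˣ) (J : Finset (Fin k)) (e : ℕ),
      |∑ s : Fˣ, ∏ j ∈ J, H (X j u * s ^ e)| ≤ q - 1 := by
    intro u J e
    refine (Finset.abs_sum_le_sum_abs _ _).trans ?_
    refine (Finset.sum_le_card_nsmul _ _ 1 fun s _ =>
      Finset.abs_prod_le_one _ _ fun j _ => hH1 _).trans ?_
    rw [Finset.card_univ, nsmul_eq_mul, mul_one, hunits']
  have htorus : |∑ u : Fin m → Fˣ, ∏ j, H (X j u)| ≤
      (4 * W ^ 2 + k * k * D) * (q : ℝ) ^ (m - 1) := by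
    have hkey := sum_units_prod_eq i A hAd H
    rw [hunits'] at hkey
    have hqpos : (0 : ℝ) < (q - 1) ^ 2 := by
      have : (0 : ℝ) < q - 1 := by linarith
      positivity
    refine le_of_mul_le_mul_left ?_ hqpos
    rw [← abs_of_pos hqpos, ← abs_mul, hkey, abs_of_pos hqpos]
    have hterm : ∀ u : Fin m → Fˣ,
        |(∑ s : Fˣ, ∏ j with i ∈ A j, H (X j u * s ^ 1)) *
          ∑ t : Fˣ, ∏ j with i ∉ A j, H (X j u * t ^ d)| ≤
          W ^ 2 * q + if u ∈ bad then ((q : ℝ) - 1) ^ 2 else 0 := by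
      intro u
      rw [abs_mul]
      split_ifs with hu
      · have := mul_le_mul (htriv u {j | i ∈ A j} 1) (htriv u {j | i ∉ A j} d) (abs_nonneg _)
          (by linarith)
        have h2 : 0 ≤ W ^ 2 * (q : ℝ) := by positivity
        linarith
      · have := mul_le_mul (hgood u hu {j | i ∈ A j} j₁ (by simpa using hi₁) 1 one_ne_zero hd)
          (hgood u hu {j | i ∉ A j} j₂ (by simpa using hi₂) d (by omega) le_rfl) (abs_nonneg _)
          (by positivity)
        refine this.trans (le_of_eq ?_)
        rw [add_zero]
        linear_combination W ^ 2 * hsq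
    refine (Finset.abs_sum_le_sum_abs _ _).trans ((Finset.sum_le_sum fun u _ => hterm u).trans ?_)
    rw [Finset.sum_add_distrib, Finset.sum_const, Finset.card_univ, ← Finset.sum_filter,
      Finset.sum_const, Finset.filter_univ_mem, nsmul_eq_mul, nsmul_eq_mul, Fintype.card_fun,
      Fintype.card_fin, hunits]
    have h1 : (((q - 1) ^ m : ℕ) : ℝ) ≤ q ^ m := by
      exact_mod_cast Nat.pow_le_pow_left (Nat.sub_le q 1) m
    have h2 : (q : ℝ) ^ m = q ^ (m - 1) * q := by
      rw [← pow_succ, Nat.sub_add_cancel (by omega)]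
    have h3 : (q : ℝ) ^ 2 ≤ 4 * (q - 1) ^ 2 := by nlinarith
    calc (((q - 1) ^ m : ℕ) : ℝ) * (W ^ 2 * q) + bad.card * ((q : ℝ) - 1) ^ 2
        ≤ (q ^ (m - 1) * q) * (W ^ 2 * q) + (k * k * D * q ^ (m - 1)) * ((q : ℝ) - 1) ^ 2 := by
          rw [← h2]
          gcongr
      _ = W ^ 2 * q ^ (m - 1) * (q : ℝ) ^ 2 + (k * k * D * q ^ (m - 1)) * ((q : ℝ) - 1) ^ 2 := by
          ring
      _ ≤ W ^ 2 * q ^ (m - 1) * (4 * (q - 1) ^ 2) +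
          (k * k * D * q ^ (m - 1)) * ((q : ℝ) - 1) ^ 2 := by
          gcongr
      _ = (q - 1) ^ 2 * ((4 * W ^ 2 + k * k * D) * (q : ℝ) ^ (m - 1)) := by ring
  have hfull := abs_sum_le_abs_sum_units_add m (fun a : Fin m → F => ∏ j, H (∏ l ∈ A j, a l))
    fun a => Finset.abs_prod_le_one _ _ fun j _ => hH1 _
  have hcast : ∀ u : Fin m → Fˣ, ∏ j, H (∏ l ∈ A j, (u l : F)) = ∏ j, H (X j u) := by
    intro u
    simp [hX]
  simp only [hcast] at hfull
  refine hfull.trans ?_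
  rw [add_mul _ (m : ℝ)]
  linarith
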